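/- As $x \to \infty$, $\sum_{1 \le n \le x^{1/3}} \sqrt{n^2 + \frac{8x}{n}} = (3 - 2F(0))\, x^{2/3} + 2^{3/2}\zeta\left(\frac{1}{2}\right)\sqrt{x} + O(x^{1/3})$, where the sum ranges over positive integers $n$ with $n \le x^{1/3}$ and $\zeta$ denotes the Riemann zeta function (analytically continued, so $\zeta(1/2)$ is its value at $1/2$). -/

import Mathlib

open Filter Asymptotics

/-- `F y = ∫_y^{1/2} (2 t^{5/2} - t^{-1/2}) / √(1 + t³) dt`. -/
noncomputable def F (y : ℝ) : ℝ :=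
  ∫ t in y..(1 / 2 : ℝ),
    (2 * t ^ ((5 : ℝ) / 2) - t ^ (-(1 : ℝ) / 2)) / Real.sqrt (1 + t ^ 3)


noncomputable def zaTerm (n : ℕ) (s : ℂ) : ℂ :=
  (((n:ℝ)+1 : ℝ) : ℂ) ^ (-s)
    - ((((n:ℝ)+2 : ℝ) : ℂ) ^ (1-s) - (((n:ℝ)+1 : ℝ) : ℂ) ^ (1-s)) / (1-s)

lemma zaTerm_bound (n : ℕ) (s : ℂ) (h1 : 1/4 ≤ s.re) (h2 : s ≠ 1) (h3 : ‖s‖ ≤ 10) :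
    ‖zaTerm n s‖ ≤ 10 * ((n:ℝ)+1) ^ (-(5/4) : ℝ) := by
  have hs0 : -s ≠ 0 := by
    intro h
    have : s = 0 := by simpa using h
    rw [this] at h1; norm_num at h1
  have hs1 : 1 - s ≠ 0 := sub_ne_zero.mpr (Ne.symm h2)
  set m : ℝ := (n:ℝ)+1 with hm
  have hm1 : 1 ≤ m := by rw [hm]; linarith [(Nat.cast_nonneg n : (0:ℝ) ≤ n)]
  have hm2 : (n:ℝ)+2 = m + 1 := by rw [hm]; ring
  have hC : ∀ t ∈ Set.Icc m (m+1), ‖(m:ℂ)^(-s) - (t:ℂ)^(-s)‖ ≤ 10 * m ^ (-(5/4) : ℝ) := by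
    intro t ht
    have key := Convex.norm_image_sub_le_of_norm_hasDerivWithin_le (𝕜 := ℝ)
      (f := fun t : ℝ => (t:ℂ)^(-s)) (f' := fun t : ℝ => (-s) * (t:ℂ)^(-s-1))
      (s := Set.Icc m (m+1)) (x := t) (y := m) (C := 10 * m ^ (-(5/4) : ℝ))
      (fun u hu => (hasDerivAt_ofReal_cpow_const (by linarith [hu.1]) hs0).hasDerivWithinAt)
      (fun u hu => by
        have hu0 : 0 < u := by linarith [hu.1]
        rw [norm_mul, norm_neg, Complex.norm_cpow_eq_rpow_re_of_pos hu0]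
        refine mul_le_mul h3 ?_ (by positivity) (by norm_num)
        calc u ^ (-s-1).re ≤ u ^ (-(5/4) : ℝ) := by
              apply Real.rpow_le_rpow_of_exponent_le (by linarith [hu.1])
              simp; linarith
          _ ≤ m ^ (-(5/4) : ℝ) :=
              Real.rpow_le_rpow_of_nonpos (by linarith) hu.1 (by norm_num))
      (convex_Icc _ _) ht ⟨le_rfl, by linarith⟩
    refine key.trans ?_
    have : ‖m - t‖ ≤ 1 := by
      rw [Real.norm_eq_abs, abs_le]; constructor <;> linarith [ht.1, ht.2]
    exact mul_le_of_le_one_right (by positivity) this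
  have key := Convex.norm_image_sub_le_of_norm_hasDerivWithin_le (𝕜 := ℝ)
      (f := fun t : ℝ => (t:ℂ) * (m:ℂ)^(-s) - (t:ℂ)^(1-s) / (1-s))
      (f' := fun t : ℝ => (m:ℂ)^(-s) - (t:ℂ)^(-s))
      (s := Set.Icc m (m+1)) (x := m) (y := m+1) (C := 10 * m ^ (-(5/4) : ℝ))
      (fun u hu => by
        have h := (hasDerivAt_ofReal_cpow_const (x := u) (by linarith [hu.1]) hs1).div_const (1-s)
        have h' := ((Complex.ofRealCLM.hasDerivAt (x := u)).mul_const ((m:ℂ)^(-s))).sub h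
        refine (h'.congr_deriv ?_).hasDerivWithinAt
        have : 1 - s - 1 = -s := by ring
        rw [this]
        field_simp
        simp)
      hC (convex_Icc _ _) ⟨le_rfl, by linarith⟩ ⟨by linarith, le_rfl⟩
  have e : zaTerm n s = (((m+1:ℝ):ℂ) * (m:ℂ)^(-s) - ((m+1:ℝ):ℂ)^(1-s) / (1-s))
      - ((m:ℂ) * (m:ℂ)^(-s) - (m:ℂ)^(1-s) / (1-s)) := by
    unfold zaTerm
    rw [← hm, hm2]; push_cast; ring
  rw [e]
  simpa using key

lemma za_summable : Summable (fun n : ℕ => 10 * ((n:ℝ)+1) ^ (-(5/4) : ℝ)) := by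
  apply Summable.mul_left
  have := (summable_nat_add_iff (f := fun n : ℕ => (n:ℝ)^(-(5/4):ℝ)) 1).mpr
    (Real.summable_nat_rpow.mpr (by norm_num))
  simpa using this

def zaU : Set ℂ := {s | 1/4 < s.re} ∩ {s | s.re - s.im < 1} ∩ Metric.ball 0 10

lemma za_partial (N : ℕ) (s : ℂ) (h2 : s ≠ 1) : ∑ n ∈ Finset.range N, zaTerm n s =
    ∑ n ∈ Finset.range N, (((n:ℝ)+1 : ℝ) : ℂ) ^ (-s)
      - ((((N:ℝ)+1:ℝ):ℂ)^(1-s) - 1) / (1-s) := by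
  have := Finset.sum_range_sub (fun n : ℕ => (((n:ℝ)+1:ℝ):ℂ)^(1-s)) N
  simp only [zaTerm, Finset.sum_sub_distrib, ← Finset.sum_div]
  rw [← Finset.sum_sub_distrib]
  congr 2
  have e : ∀ n : ℕ, (n:ℝ)+2 = ((n+1:ℕ):ℝ)+1 := by intro n; push_cast; ring
  simp only [e, this]
  simp

lemma za_hasSum_zeta (s : ℂ) (hs : 1 < s.re) (h3 : ‖s‖ ≤ 10) :
    ∑' n, zaTerm n s = riemannZeta s + 1 / (1-s) := by
  have h2 : s ≠ 1 := by rintro rfl; simp at hs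
  have hsum : Summable (fun n => zaTerm n s) :=
    Summable.of_norm_bounded za_summable (fun n => zaTerm_bound n s (by linarith) h2 h3)
  have t1 := hsum.hasSum.tendsto_sum_nat
  have hz : Summable (fun n : ℕ => 1 / ((n:ℂ)+1)^s) := by
    have := (summable_nat_add_iff (f := fun n : ℕ => 1 / (n:ℂ)^s) 1).mpr
      (Complex.summable_one_div_nat_cpow.mpr hs)
    simpa using this
  have t2 := hz.hasSum.tendsto_sum_nat
  rw [← zeta_eq_tsum_one_div_nat_add_one_cpow hs] at t2
  have t3 : Tendsto (fun N : ℕ => (((N:ℝ)+1:ℝ):ℂ)^(1-s)) atTop (nhds 0) := by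
    rw [tendsto_zero_iff_norm_tendsto_zero]
    have : ∀ N : ℕ, ‖(((N:ℝ)+1:ℝ):ℂ)^(1-s)‖ = ((N:ℝ)+1)^(-(s.re-1)) := by
      intro N
      rw [Complex.norm_cpow_eq_rpow_re_of_pos (by positivity)]
      simp
    simp only [this]
    exact (tendsto_rpow_neg_atTop (by linarith)).comp
      (tendsto_atTop_add_const_right _ _ tendsto_natCast_atTop_atTop)
  have t4 := t2.sub ((t3.sub_const 1).div_const (1-s))
  have e : (fun N => ∑ n ∈ Finset.range N, zaTerm n s) = fun N : ℕ =>
      ∑ n ∈ Finset.range N, 1 / ((n:ℂ)+1)^s - ((((N:ℝ)+1:ℝ):ℂ)^(1-s) - 1) / (1-s) := by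
    funext N
    rw [za_partial N s h2]
    simp [Complex.cpow_neg]
  rw [e] at t1
  have := tendsto_nhds_unique t1 t4
  rw [this]; ring

lemma za_half : HasSum (fun n => zaTerm n (1/2)) (riemannZeta (1/2) + 2) := by
  have hopen : IsOpen zaU := by
    refine (IsOpen.inter ?_ ?_).inter Metric.isOpen_ball
    · exact isOpen_lt continuous_const Complex.continuous_re
    · exact isOpen_lt (Complex.continuous_re.sub Complex.continuous_im) continuous_const
  have hconv : Convex ℝ zaU := by
    refine (Convex.inter ?_ ?_).inter (convex_ball _ _)
    · exact convex_halfSpace_gt Complex.reLm.isLinear _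
    · exact convex_halfSpace_lt (Complex.reLm - Complex.imLm).isLinear _
  have hne : ∀ s ∈ zaU, s ≠ 1 := by
    rintro s hs rfl
    have := hs.1.2
    simp at this
  have hbd : ∀ (n : ℕ) (s : ℂ), s ∈ zaU → ‖zaTerm n s‖ ≤ 10 * ((n:ℝ)+1) ^ (-(5/4) : ℝ) := by
    intro n s hs
    exact zaTerm_bound n s (le_of_lt hs.1.1) (hne s hs) (le_of_lt (by simpa using hs.2))
  have hd1 : DifferentiableOn ℂ (fun s => ∑' n, zaTerm n s) zaU := by
    refine Complex.differentiableOn_tsum_of_summable_norm za_summable ?_ hopen hbd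
    intro n s hs
    have hs1 : 1 - s ≠ 0 := sub_ne_zero.mpr (Ne.symm (hne s hs))
    have p1 : (((n:ℝ)+1:ℝ):ℂ) ≠ 0 := by
      rw [Complex.ofReal_ne_zero]; positivity
    have p2 : (((n:ℝ)+2:ℝ):ℂ) ≠ 0 := by
      rw [Complex.ofReal_ne_zero]; positivity
    have d0 : DifferentiableAt ℂ (fun s : ℂ => 1 - s) s := by fun_prop
    have d00 : DifferentiableAt ℂ (fun s : ℂ => - s) s := by fun_prop
    exact ((d00.const_cpow (Or.inl p1)).sub
      (((d0.const_cpow (Or.inl p2)).sub (d0.const_cpow (Or.inl p1))).div d0 hs1)).differentiableWithinAt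
  have hd2 : DifferentiableOn ℂ (fun s => riemannZeta s + 1 / (1-s)) zaU := by
    intro s hs
    have hs1 : 1 - s ≠ 0 := sub_ne_zero.mpr (Ne.symm (hne s hs))
    have d0 : DifferentiableAt ℂ (fun s : ℂ => 1 - s) s := by fun_prop
    exact ((differentiableAt_riemannZeta (hne s hs)).add
      ((differentiableAt_const _).div d0 hs1)).differentiableWithinAt
  have hz0 : (2 + 2 * Complex.I) ∈ zaU := by
    refine ⟨⟨?_, ?_⟩, ?_⟩
    · simp; norm_num
    · simp
    · simp only [Metric.mem_ball, dist_zero_right]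
      refine (norm_add_le _ _).trans_lt ?_
      simp; norm_num
  have hhalf : (1/2 : ℂ) ∈ zaU := by
    refine ⟨⟨?_, ?_⟩, ?_⟩
    · simp; norm_num
    · simp; norm_num
    · simp; norm_num
  have heq := AnalyticOnNhd.eqOn_of_preconnected_of_eventuallyEq
    (hd1.analyticOnNhd hopen) (hd2.analyticOnNhd hopen) hconv.isPreconnected hz0 (by
      have o2 : IsOpen {s : ℂ | 1 < s.re} := isOpen_lt continuous_const Complex.continuous_re
      filter_upwards [hopen.mem_nhds hz0, o2.mem_nhds (by simp : (2 + 2 * Complex.I) ∈ {s : ℂ | 1 < s.re})]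
        with s h1 h2
      exact za_hasSum_zeta s h2 (le_of_lt (by simpa using h1.2)))
  have h := heq hhalf
  have hsum : Summable (fun n => zaTerm n (1/2)) :=
    Summable.of_norm_bounded za_summable (fun n => hbd n _ hhalf)
  have := hsum.hasSum
  simp only at h
  rw [h] at this
  convert this using 2
  norm_num

lemma sum_Icc_range (f : ℕ → ℝ) (N : ℕ) :
    ∑ n ∈ Finset.Icc 1 N, f n = ∑ n ∈ Finset.range N, f (n+1) := by
  rw [Finset.range_eq_Ico, Finset.sum_Ico_add' f 0 N 1]
  rfl

lemma zeta_half_bound : ∃ c : ℝ, riemannZeta (1/2) = (c:ℂ) ∧ ∀ N : ℕ, 1 ≤ N →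
    |∑ n ∈ Finset.Icc 1 N, 1 / Real.sqrt n - 2 * Real.sqrt N - c| ≤ 1 / Real.sqrt N := by
  let S : ℕ → ℝ := fun N => ∑ n ∈ Finset.range N, 1 / Real.sqrt ((n:ℝ)+1)
  let v : ℕ → ℝ := fun N => S N - 2 * Real.sqrt ((N:ℝ)+1)
  have hterm : ∀ N : ℕ, ∑ n ∈ Finset.range N, zaTerm n (1/2) = ((v N + 2 : ℝ) : ℂ) := by
    intro N
    rw [za_partial N _ (by norm_num)]
    have e1 : ∀ n : ℕ, (((n:ℝ)+1 : ℝ) : ℂ) ^ (-(1/2) : ℂ) = ((1 / Real.sqrt ((n:ℝ)+1) : ℝ) : ℂ) := by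
      intro n
      have : (-(1/2) : ℂ) = ((-(1/2) : ℝ) : ℂ) := by push_cast; ring
      rw [this, ← Complex.ofReal_cpow (by positivity), Real.rpow_neg (by positivity),
        ← Real.sqrt_eq_rpow, one_div]
    have e2 : (((N:ℝ)+1 : ℝ) : ℂ) ^ (1-(1/2) : ℂ) = ((Real.sqrt ((N:ℝ)+1) : ℝ) : ℂ) := by
      have : (1-(1/2) : ℂ) = (((1/2) : ℝ) : ℂ) := by push_cast; ring
      rw [this, ← Complex.ofReal_cpow (by positivity), ← Real.sqrt_eq_rpow]
    rw [e2]
    simp only [e1, v, S]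
    push_cast
    ring
  have ht := za_half.tendsto_sum_nat
  simp only [hterm] at ht
  have hre := (Complex.continuous_re.tendsto _).comp ht
  have him := (Complex.continuous_im.tendsto _).comp ht
  simp only [Function.comp_def, Complex.ofReal_re, Complex.ofReal_im] at hre him
  have him0 := tendsto_nhds_unique him tendsto_const_nhds
  set c := (riemannZeta (1/2)).re with hc
  have hv : Tendsto v atTop (nhds c) := by
    have h0 := hre.sub_const 2
    have e0 : (riemannZeta (1/2) + 2).re - 2 = c := by rw [hc, Complex.add_re]; simp
    rw [e0] at h0
    simpa using h0
  have hsq : ∀ N : ℕ, Real.sqrt ((N:ℝ)+1) - Real.sqrt N = 1 / (Real.sqrt ((N:ℝ)+1) + Real.sqrt N) := by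
    intro N
    have h1 := Real.sq_sqrt (show (0:ℝ) ≤ (N:ℝ)+1 by positivity)
    have h2 := Real.sq_sqrt (show (0:ℝ) ≤ (N:ℝ) by positivity)
    have h3 : 0 < Real.sqrt ((N:ℝ)+1) := by positivity
    have h4 := Real.sqrt_nonneg (N:ℝ)
    rw [eq_div_iff (by positivity)]
    nlinarith
  let u : ℕ → ℝ := fun N => S N - 2 * Real.sqrt N
  have hle : ∀ N : ℕ, Real.sqrt N ≤ Real.sqrt ((N:ℝ)+1) := fun N => Real.sqrt_le_sqrt (by linarith)
  have hS : ∀ N : ℕ, S (N+1) = S N + 1 / Real.sqrt ((N:ℝ)+1) := by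
    intro N; simp only [S, Finset.sum_range_succ]
  have hvm : Monotone v := by
    apply monotone_nat_of_le_succ
    intro N
    have := hsq (N+1)
    have h2 := hle (N+1)
    push_cast at this h2
    simp only [v, hS]
    push_cast
    have h3 : 0 < Real.sqrt ((N:ℝ)+1) := by positivity
    have : 1 / (Real.sqrt ((N:ℝ)+1+1) + Real.sqrt ((N:ℝ)+1)) ≤ 1 / (2 * Real.sqrt ((N:ℝ)+1)) :=
      one_div_le_one_div_of_le (by positivity) (by linarith)
    have e : 1 / (2 * Real.sqrt ((N:ℝ)+1)) = 1/2 * (1 / Real.sqrt ((N:ℝ)+1)) := by field_simp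
    linarith
  have hua : Antitone u := by
    apply antitone_nat_of_succ_le
    intro N
    have := hsq N
    have h2 := hle N
    simp only [u, hS]
    push_cast
    have h3 : 0 < Real.sqrt ((N:ℝ)+1) := by positivity
    have h4 := Real.sqrt_nonneg (N:ℝ)
    have : 1 / (2 * Real.sqrt ((N:ℝ)+1)) ≤ 1 / (Real.sqrt ((N:ℝ)+1) + Real.sqrt (N:ℝ)) :=
      one_div_le_one_div_of_le (by positivity) (by linarith)
    have e : 1 / (2 * Real.sqrt ((N:ℝ)+1)) = 1/2 * (1 / Real.sqrt ((N:ℝ)+1)) := by field_simp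
    linarith
  have hvc : ∀ N, v N ≤ c := fun N => hvm.ge_of_tendsto hv N
  have huc : ∀ N, c ≤ u N := by
    intro N
    apply le_of_tendsto hv
    filter_upwards [eventually_ge_atTop N] with M hM
    refine le_trans ?_ (hua hM)
    simp only [u, v]
    linarith [hle M]
  refine ⟨c, ?_, ?_⟩
  · apply Complex.ext
    · simp [hc]
    · simpa using him0
  · intro N hN
    rw [sum_Icc_range (fun n => 1 / Real.sqrt n)]
    have e : ∑ n ∈ Finset.range N, 1 / Real.sqrt ((n+1:ℕ):ℝ) = S N := by simp [S]
    rw [e]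
    have h1 := huc N
    have h2 := hvc N
    simp only [u, v] at h1 h2
    have h3 := hsq N
    have hN' : (1:ℝ) ≤ N := by exact_mod_cast hN
    have h5 : 0 < Real.sqrt N := by positivity
    have h4 : 1 / (Real.sqrt ((N:ℝ)+1) + Real.sqrt (N:ℝ)) ≤ 1 / (2 * Real.sqrt (N:ℝ)) :=
      one_div_le_one_div_of_le (by positivity) (by linarith [hle N])
    have e : 1 / (2 * Real.sqrt (N:ℝ)) = 1/2 * (1 / Real.sqrt (N:ℝ)) := by field_simp
    rw [abs_of_nonneg (by linarith)]
    linarith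

noncomputable def hh (u : ℝ) : ℝ := Real.sqrt (u^2 + 8/u) - Real.sqrt (8/u)

lemma hh_nonneg (u : ℝ) : 0 ≤ hh u := by
  unfold hh
  have := Real.sqrt_le_sqrt (show 8/u ≤ u^2 + 8/u by nlinarith [sq_nonneg u])
  linarith

lemma hh_le (u : ℝ) (hu : 0 ≤ u) : hh u ≤ u := by
  unfold hh
  rw [sub_le_iff_le_add]
  apply Real.sqrt_le_iff.mpr
  have h0 : 0 ≤ 8/u := by positivity
  refine ⟨by positivity, ?_⟩
  nlinarith [Real.sq_sqrt h0, Real.sqrt_nonneg (8/u), mul_nonneg hu (Real.sqrt_nonneg (8/u))]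

lemma hh_mono : MonotoneOn hh (Set.Icc 0 1) := by
  intro a ha b hb hab
  rcases eq_or_lt_of_le ha.1 with h | h
  · rw [← h]
    refine le_trans (le_of_eq ?_) (hh_nonneg b)
    simp [hh]
  have hb0 : 0 < b := by linarith
  have key : ∀ u, 0 < u → hh u * (Real.sqrt (u^2+8/u) + Real.sqrt (8/u)) = u^2 := by
    intro u hu
    unfold hh
    have h1 := Real.sq_sqrt (show 0 ≤ u^2+8/u by positivity)
    have h2 := Real.sq_sqrt (show 0 ≤ 8/u by positivity)
    nlinarith
  have h8 : 8/b ≤ 8/a := by gcongr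
  have h9 : b^2+8/b ≤ a^2+8/a := by
    have : 8/a - 8/b = 8*(b-a)/(a*b) := by field_simp
    have h2 : 8*(b-a) ≤ 8*(b-a)/(a*b) := by
      rw [le_div_iff₀ (by positivity)]
      have : a*b ≤ 1 := by nlinarith [ha.2, hb.2]
      nlinarith
    nlinarith [ha.2, hb.2]
  have r1 := Real.sqrt_le_sqrt h8
  have r2 := Real.sqrt_le_sqrt h9
  have p : 0 < Real.sqrt (8/b) := by positivity
  have ka := key a h
  have kb := key b hb0
  by_contra hcon
  push Not at hcon
  have q1 := Real.sqrt_nonneg (b^2+8/b)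
  have : hh b * (Real.sqrt (b^2+8/b) + Real.sqrt (8/b)) < hh a * (Real.sqrt (a^2+8/a) + Real.sqrt (8/a)) :=
    mul_lt_mul hcon (by linarith) (by positivity) (hh_nonneg a)
  nlinarith

lemma hh_integral : ∫ u in (0:ℝ)..1, hh u = 3 - 2 * F 0 - 2 * Real.sqrt 8 := by
  have e1 : ∫ u in (0:ℝ)..1, hh u = 2 * ∫ t in (0:ℝ)..(1/2), hh (2*t) := by
    rw [intervalIntegral.integral_comp_mul_left hh (by norm_num)]
    norm_num
    ring
  have i1 : IntervalIntegrable (fun t => hh (2*t)) MeasureTheory.volume 0 (1/2) := by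
    apply MonotoneOn.intervalIntegrable
    rw [Set.uIcc_of_le (by norm_num)]
    intro a ha b hb hab
    exact hh_mono ⟨by linarith [ha.1], by linarith [ha.2]⟩ ⟨by linarith [hb.1], by linarith [hb.2]⟩
      (by linarith)
  have i2 : IntervalIntegrable (fun t : ℝ => (2 * t ^ ((5 : ℝ) / 2) - t ^ (-(1 : ℝ) / 2)) / Real.sqrt (1 + t ^ 3))
      MeasureTheory.volume 0 (1/2) := by
    simp only [div_eq_mul_inv (_ - _ : ℝ)]
    apply IntervalIntegrable.mul_continuousOn
    · exact ((intervalIntegral.intervalIntegrable_rpow' (by norm_num)).const_mul 2).sub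
        (intervalIntegral.intervalIntegrable_rpow' (by norm_num))
    · rw [Set.uIcc_of_le (by norm_num)]
      apply ContinuousOn.inv₀ (by fun_prop)
      intro t ht
      have : 0 ≤ t := ht.1
      positivity
  have ftc := intervalIntegral.integral_eq_sub_of_hasDerivAt_of_le (a := 0) (b := 1/2)
    (f := fun t : ℝ => 4 * (Real.sqrt t * Real.sqrt (1+t^3)) - 8 * Real.sqrt t)
    (f' := fun t : ℝ => 2 * hh (2*t) + 2 * ((2 * t ^ ((5 : ℝ) / 2) - t ^ (-(1 : ℝ) / 2)) / Real.sqrt (1 + t ^ 3)))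
    (by norm_num) (by fun_prop) (by
      intro t ht
      have ht0 : 0 < t := ht.1
      have d1 := Real.hasDerivAt_sqrt ht0.ne'
      have d2 : HasDerivAt (fun t : ℝ => 1 + t^3) (3*t^2) t := by
        simpa using (hasDerivAt_pow 3 t).const_add 1
      have d3 := d2.sqrt (by positivity)
      refine (((d1.mul d3).const_mul 4).sub (d1.const_mul 8)).congr_deriv ?_
      have r5 : t ^ ((5:ℝ)/2) = t^2 * Real.sqrt t := by
        rw [Real.sqrt_eq_rpow, ← Real.rpow_natCast, ← Real.rpow_add ht0]; norm_num
      have r1 : t ^ (-(1:ℝ)/2) = 1 / Real.sqrt t := by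
        rw [Real.sqrt_eq_rpow, neg_div, Real.rpow_neg ht0.le, inv_eq_one_div]
      have g1 : Real.sqrt (8/(2*t)) = 2 / Real.sqrt t := by
        rw [show 8/(2*t) = 2^2/t by field_simp; norm_num, Real.sqrt_div (by norm_num),
          Real.sqrt_sq (by norm_num)]
      have g2 : Real.sqrt ((2*t)^2 + 8/(2*t)) = 2 * Real.sqrt (1+t^3) / Real.sqrt t := by
        rw [show (2*t)^2 + 8/(2*t) = 2^2*(1+t^3)/t by field_simp; ring, Real.sqrt_div (by positivity),
          Real.sqrt_mul (by norm_num), Real.sqrt_sq (by norm_num)]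
      rw [r5, r1, hh, g1, g2]
      have hs := Real.sq_sqrt ht0.le
      have hw := Real.sq_sqrt (show 0 ≤ 1+t^3 by positivity)
      have hs0 : 0 < Real.sqrt t := by positivity
      have hw0 : 0 < Real.sqrt (1+t^3) := by positivity
      set a := Real.sqrt t
      set w := Real.sqrt (1+t^3)
      field_simp
      have hw' : w^2 = 1 + a^6 := by rw [hw, ← hs]; ring
      rw [← hs]
      ring_nf
      simp only [hw']
      ring)
    ((i1.const_mul 2).add (i2.const_mul 2))
  rw [intervalIntegral.integral_add (i1.const_mul 2) (i2.const_mul 2),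
    intervalIntegral.integral_const_mul, intervalIntegral.integral_const_mul, ← e1] at ftc
  have eF : F 0 = ∫ t in (0:ℝ)..(1/2), (2 * t ^ ((5 : ℝ) / 2) - t ^ (-(1 : ℝ) / 2)) / Real.sqrt (1 + t ^ 3) := rfl
  rw [← eF] at ftc
  have s1 : Real.sqrt (1/2) * Real.sqrt (1+(1/2)^3) = 3/4 := by
    rw [← Real.sqrt_mul (by norm_num), show (1/2 * (1+(1/2)^3) : ℝ) = (3/4)^2 by norm_num,
      Real.sqrt_sq (by norm_num)]
  have s2 : 8 * Real.sqrt (1/2) = 2 * Real.sqrt 8 := by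
    rw [show (8:ℝ) = 4^2 * (1/2) by norm_num, Real.sqrt_mul (by norm_num), Real.sqrt_sq (by norm_num)]
    ring
  simp only [s1, s2] at ftc
  simp at ftc
  linarith

lemma hh_sum (X : ℝ) (hX : 1 ≤ X) :
    |∑ n ∈ Finset.Icc 1 ⌊X⌋₊, hh (n / X) - X * ∫ u in (0:ℝ)..1, hh u| ≤ 1 := by
  set N := ⌊X⌋₊ with hN
  have hX0 : 0 < X := by linarith
  have hNX : (N:ℝ) ≤ X := Nat.floor_le hX0.le
  have hXN : X < N + 1 := Nat.lt_floor_add_one X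
  have hm : MonotoneOn (fun t => hh (t/X)) (Set.Icc 0 X) := by
    intro a ha b hb hab
    refine hh_mono ⟨div_nonneg ha.1 hX0.le, (div_le_one hX0).mpr ha.2⟩
      ⟨div_nonneg hb.1 hX0.le, (div_le_one hX0).mpr hb.2⟩ (by gcongr)
  have hmN : MonotoneOn (fun t => hh (t/X)) (Set.Icc 0 (0+(N:ℝ))) :=
    hm.mono (Set.Icc_subset_Icc le_rfl (by linarith))
  have a1 := hmN.sum_le_integral
  have a2 := hmN.integral_le_sum
  simp only [zero_add] at a1 a2
  rw [sum_Icc_range (fun n => hh (n/X))]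
  have esum := Finset.sum_range_succ' (fun i : ℕ => hh ((i:ℝ)/X)) N
  rw [Finset.sum_range_succ] at esum
  have h00 : hh (((0:ℕ):ℝ)/X) = 0 := by simp [hh]
  have hNle : hh ((N:ℝ)/X) ≤ 1 := (hh_le _ (by positivity)).trans ((div_le_one hX0).mpr hNX)
  have eint : X * ∫ u in (0:ℝ)..1, hh u = ∫ t in (0:ℝ)..X, hh (t/X) := by
    rw [intervalIntegral.integral_comp_div hh hX0.ne']
    simp [hX0.ne']
  have hi1 : IntervalIntegrable (fun t => hh (t/X)) MeasureTheory.volume 0 N := by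
    apply MonotoneOn.intervalIntegrable
    rw [Set.uIcc_of_le (by positivity)]
    exact hm.mono (Set.Icc_subset_Icc le_rfl hNX)
  have hi2 : IntervalIntegrable (fun t => hh (t/X)) MeasureTheory.volume N X := by
    apply MonotoneOn.intervalIntegrable
    rw [Set.uIcc_of_le hNX]
    exact hm.mono (Set.Icc_subset_Icc (by positivity) le_rfl)
  have esplit := intervalIntegral.integral_add_adjacent_intervals hi1 hi2
  have b1 : 0 ≤ ∫ t in (N:ℝ)..X, hh (t/X) :=
    intervalIntegral.integral_nonneg hNX (fun t _ => hh_nonneg _)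
  have b2 : ∫ t in (N:ℝ)..X, hh (t/X) ≤ ∫ t in (N:ℝ)..X, (1:ℝ) := by
    apply intervalIntegral.integral_mono_on hNX hi2 (by simp)
    intro t ht
    have : 0 ≤ t := le_trans (by positivity) ht.1
    exact (hh_le _ (by positivity)).trans ((div_le_one hX0).mpr ht.2)
  simp at b2
  rw [eint, ← esplit, abs_le]
  constructor <;> linarith

lemma main_bound (c : ℝ) (hc : ∀ N : ℕ, 1 ≤ N →
    |∑ n ∈ Finset.Icc 1 N, 1 / Real.sqrt n - 2 * Real.sqrt N - c| ≤ 1 / Real.sqrt N)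
    (X : ℝ) (hX : 1 ≤ X) :
    |∑ n ∈ Finset.Icc 1 ⌊X⌋₊, Real.sqrt ((n:ℝ)^2 + 8 * X^3 / n)
      - ((3 - 2 * F 0) * X^2 + Real.sqrt 8 * c * Real.sqrt (X^3))| ≤ 13 * X := by
  have hs := hh_sum X hX
  have hz := hc ⌊X⌋₊ (Nat.one_le_floor_iff X |>.mpr hX)
  rw [hh_integral] at hs
  set N := ⌊X⌋₊ with hN
  have hX0 : 0 < X := by linarith
  have hNX : (N:ℝ) ≤ X := Nat.floor_le hX0.le
  have hXN : X < N + 1 := Nat.lt_floor_add_one X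
  have hN1 : (1:ℝ) ≤ N := by exact_mod_cast (Nat.one_le_floor_iff X |>.mpr hX)
  have hx3 : Real.sqrt (X^3) = X * Real.sqrt X := by
    rw [show X^3 = X^2 * X by ring, Real.sqrt_mul (by positivity), Real.sqrt_sq hX0.le]
  have e : ∑ n ∈ Finset.Icc 1 N, Real.sqrt ((n:ℝ)^2 + 8 * X^3 / n) =
      X * ∑ n ∈ Finset.Icc 1 N, hh (n / X) +
        Real.sqrt 8 * (X * Real.sqrt X) * ∑ n ∈ Finset.Icc 1 N, 1 / Real.sqrt n := by
    rw [Finset.mul_sum, Finset.mul_sum, ← Finset.sum_add_distrib]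
    apply Finset.sum_congr rfl
    intro n hn
    have hn0 : (0:ℝ) < n := by
      have := (Finset.mem_Icc.mp hn).1
      exact_mod_cast this
    have k1 : Real.sqrt (8/((n:ℝ)/X)) = Real.sqrt 8 * Real.sqrt X * (1 / Real.sqrt n) := by
      rw [show 8/((n:ℝ)/X) = 8 * X / n by field_simp, Real.sqrt_div (by positivity),
        Real.sqrt_mul (by norm_num)]
      ring
    have k2 : Real.sqrt ((n:ℝ)^2 + 8 * X^3 / n) = X * Real.sqrt (((n:ℝ)/X)^2 + 8/((n:ℝ)/X)) := by
      rw [show (n:ℝ)^2 + 8 * X^3 / n = X^2 * (((n:ℝ)/X)^2 + 8/((n:ℝ)/X)) by field_simp,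
        Real.sqrt_mul (by positivity), Real.sqrt_sq hX0.le]
    rw [hh, k2, k1]; ring
  rw [e, hx3]
  set A := ∑ n ∈ Finset.Icc 1 N, hh (n / X)
  set B := ∑ n ∈ Finset.Icc 1 N, 1 / Real.sqrt (n:ℝ)
  set a := Real.sqrt X
  set b := Real.sqrt (N:ℝ)
  have ha2 : a^2 = X := Real.sq_sqrt hX0.le
  have hb2 : b^2 = N := Real.sq_sqrt (by positivity)
  have hb0 : 0 < b := by positivity
  have ha0 : 0 < a := by positivity
  have hba : b ≤ a := Real.sqrt_le_sqrt hNX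
  have hab : a - b ≤ 1 / (2*b) := by
    rw [le_div_iff₀ (by positivity)]
    nlinarith
  have hr : Real.sqrt 8 * a * (1/b) ≤ 4 := by
    have h8 := Real.sq_sqrt (show (0:ℝ) ≤ 8 by norm_num)
    have h80 : 0 < Real.sqrt 8 := by positivity
    rw [mul_one_div, div_le_iff₀ hb0]
    apply le_of_sq_le_sq _ (by positivity)
    rw [mul_pow, mul_pow, h8, ha2, hb2]
    linarith
  have hD : |B - 2*a - c| ≤ 2 * (1/b) := by
    have e2 : 1/(2*b) = 1/2 * (1/b) := by field_simp
    rw [abs_le] at hz ⊢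
    constructor <;> linarith
  have id1 : X * A + Real.sqrt 8 * (X*a) * B - ((3 - 2 * F 0) * X^2 + Real.sqrt 8 * c * (X*a))
      = X * (A - X * (3 - 2 * F 0 - 2 * Real.sqrt 8)) + Real.sqrt 8 * (X*a) * (B - 2*a - c) := by
    have : X^2 = X * a^2 := by rw [ha2]; ring
    linear_combination (2 * Real.sqrt 8 * X) * ha2
  rw [id1]
  refine (abs_add_le _ _).trans ?_
  rw [abs_mul, abs_mul, abs_of_pos hX0, abs_of_nonneg (show 0 ≤ Real.sqrt 8 * (X*a) by positivity)]
  have t1 : X * |A - X * (3 - 2 * F 0 - 2 * Real.sqrt 8)| ≤ X * 1 := by gcongr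
  have t2 : Real.sqrt 8 * (X*a) * |B - 2*a - c| ≤ Real.sqrt 8 * (X*a) * (2 * (1/b)) := by gcongr
  have t3 : Real.sqrt 8 * (X*a) * (2 * (1/b)) = 2 * X * (Real.sqrt 8 * a * (1/b)) := by ring
  have t4 : 2 * X * (Real.sqrt 8 * a * (1/b)) ≤ 2 * X * 4 := by gcongr
  linarith

theorem sqrt_sum_asymptotic :
    (fun x : ℝ =>
        ((∑ n ∈ Finset.Icc 1 ⌊x ^ ((1 : ℝ) / 3)⌋₊,
            Real.sqrt ((n : ℝ) ^ 2 + 8 * x / n) : ℝ) : ℂ)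
          - ((((3 - 2 * F 0) * x ^ ((2 : ℝ) / 3) : ℝ) : ℂ)
              + (2 : ℂ) ^ ((3 : ℂ) / 2) * riemannZeta (1 / 2) * (Real.sqrt x : ℂ)))
      =O[atTop] fun x : ℝ => x ^ ((1 : ℝ) / 3) := by
  obtain ⟨c, hc, hb⟩ := zeta_half_bound
  apply IsBigO.of_bound 13
  filter_upwards [eventually_ge_atTop 1] with x hx
  have hx0 : 0 ≤ x := by linarith
  have hX : 1 ≤ x ^ ((1:ℝ)/3) := Real.one_le_rpow hx (by norm_num)
  have h3 : (x ^ ((1:ℝ)/3))^3 = x := by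
    rw [← Real.rpow_natCast, ← Real.rpow_mul hx0]; norm_num
  have h2 : (x ^ ((1:ℝ)/3))^2 = x ^ ((2:ℝ)/3) := by
    rw [← Real.rpow_natCast, ← Real.rpow_mul hx0]; norm_num
  have key := main_bound c hb _ hX
  rw [h3, h2] at key
  have e8 : (2:ℂ) ^ ((3:ℂ)/2) = ((Real.sqrt 8 : ℝ) : ℂ) := by
    have : Real.sqrt 8 = (2:ℝ) ^ ((3:ℝ)/2) := by
      rw [Real.sqrt_eq_rpow, show (8:ℝ) = 2^(3:ℝ) by norm_num, ← Real.rpow_mul (by norm_num)]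
      norm_num
    rw [this, Complex.ofReal_cpow (by norm_num)]
    norm_num
  rw [e8, hc, Real.norm_of_nonneg (by linarith), ← Complex.ofReal_mul, ← Complex.ofReal_mul,
    ← Complex.ofReal_add, ← Complex.ofReal_sub, Complex.norm_real, Real.norm_eq_abs]
  exact key
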